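/- For a continuous function f : Ω → ℝ, the following are equivalent: (i) [D, π(M_f)] = 0; (ii) f ∘ σ = f; (iii) f is constant. -/

import Mathlib

open MeasureTheory ContinuousLinearMap
open scoped RealInnerProductSpace InnerProductSpace ENNReal

noncomputable section

/-- The shift space `Ω = {0,1}^ℕ`, with `false` playing the role of the symbol `0`
and `true` of the symbol `1`. -/
abbrev Ω : Type := ℕ → Bool

/-- The shift map `σ`, `σ(x)ₙ = x_{n+1}`. -/
def shiftMap : Ω → Ω := fun x n => x (n + 1)

/-- Prepending a symbol: `consSeq a x = ax`. -/
def consSeq (a : Bool) (x : Ω) : Ω := fun n => Nat.casesOn n a (fun k => x k)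

/-- The cylinder set `[w]` of sequences beginning with the finite word `w`. -/
def cylinder (w : List Bool) : Set Ω := {x | ∀ i : Fin w.length, x (i : ℕ) = w.get i}

/-- The Hilbert space `L²(μ)` (real). -/
abbrev E (μ : Measure Ω) := Lp (α := Ω) ℝ 2 μ

/-- The Hilbert space `H = L²(μ) × L²(μ)` with the norm `√(‖φ‖² + ‖ψ‖²)`. -/
abbrev HS (μ : Measure Ω) := WithLp 2 (E μ × E μ)

variable {μ : Measure Ω}

/-- The diagonal block operator `(φ, ψ) ↦ (A₁φ, A₂ψ)` on `H`. -/
def blockDiag (A₁ A₂ : E μ →L[ℝ] E μ) : HS μ →L[ℝ] HS μ :=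
  ((WithLp.prodContinuousLinearEquiv 2 ℝ (E μ) (E μ)).symm.toContinuousLinearMap).comp
    (((A₁.comp (ContinuousLinearMap.fst ℝ (E μ) (E μ))).prod
        (A₂.comp (ContinuousLinearMap.snd ℝ (E μ) (E μ)))).comp
      (WithLp.prodContinuousLinearEquiv 2 ℝ (E μ) (E μ)).toContinuousLinearMap)

/-- The antidiagonal block operator `(φ, ψ) ↦ (A₁ψ, A₂φ)` on `H`. -/
def blockAntidiag (A₁ A₂ : E μ →L[ℝ] E μ) : HS μ →L[ℝ] HS μ :=
  ((WithLp.prodContinuousLinearEquiv 2 ℝ (E μ) (E μ)).symm.toContinuousLinearMap).comp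
    (((A₁.comp (ContinuousLinearMap.snd ℝ (E μ) (E μ))).prod
        (A₂.comp (ContinuousLinearMap.fst ℝ (E μ) (E μ)))).comp
      (WithLp.prodContinuousLinearEquiv 2 ℝ (E μ) (E μ)).toContinuousLinearMap)

/-- The diagonal representation `π(A)(φ,ψ) = (Aφ, Aψ)`. -/
def diagRep (A : E μ →L[ℝ] E μ) : HS μ →L[ℝ] HS μ := blockDiag A A

/-- The Dirac operator `D(φ,ψ) = (Kψ, Lφ)` associated with the pair `(K, L)`. -/
def dirac (K L : E μ →L[ℝ] E μ) : HS μ →L[ℝ] HS μ := blockAntidiag K L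

/-- The commutator `[D, π(A)]`. -/
def commD (K L A : E μ →L[ℝ] E μ) : HS μ →L[ℝ] HS μ :=
  (dirac K L).comp (diagRep A) - (diagRep A).comp (dirac K L)

/-- The rank-one orthogonal projection onto the span of the unit vector `ψ`:
`φ ↦ ⟪ψ, φ⟫ • ψ`. -/
def rankOneProj (ψ : E μ) : E μ →L[ℝ] E μ := (innerSL ℝ ψ).smulRight ψ

/-- The Haar-basis element `e_w = 2^{ℓ(w)/2} (χ_{[w1]} - χ_{[w0]})`, as a function on `Ω`. -/
def haarFun (w : List Bool) : Ω → ℝ := fun x =>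
  (2 : ℝ) ^ ((w.length : ℝ) / 2) *
    ((cylinder (w ++ [true])).indicator 1 x - (cylinder (w ++ [false])).indicator 1 x)

lemma continuous_shiftMap : Continuous shiftMap :=
  continuous_pi fun n => continuous_apply (n + 1)

lemma continuous_consSeq (a : Bool) : Continuous (consSeq a) := by
  apply continuous_pi
  intro n
  cases n with
  | zero => exact continuous_const
  | succ k => exact continuous_apply k

/-- The Koopman operator on continuous functions: `f ↦ f ∘ σ`. -/
def koopmanC (f : C(Ω, ℝ)) : C(Ω, ℝ) := f.comp ⟨shiftMap, continuous_shiftMap⟩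

/-- The Ruelle operator on continuous functions: `(Lf)(x) = (f(0x) + f(1x))/2`. -/
def ruelleC (f : C(Ω, ℝ)) : C(Ω, ℝ) :=
  ⟨fun x => (f (consSeq false x) + f (consSeq true x)) / 2,
    ((f.continuous.comp (continuous_consSeq false)).add
      (f.continuous.comp (continuous_consSeq true))).div_const 2⟩

end

lemma cylinder_ofFn (x : Ω) (n : ℕ) :
    cylinder (List.ofFn fun i : Fin n => x i) = PiNat.cylinder (E := fun _ => Bool) x n := by
  ext y
  simp only [_root_.cylinder, Set.mem_ofPred_eq, PiNat.mem_cylinder_iff, List.get_ofFn]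
  constructor
  · intro h i hi
    simpa using h ⟨i, by simpa using hi⟩
  · intro h i
    simpa using h i (by simpa using i.2)

lemma preimage_shiftMap_cylinder (w : List Bool) :
    shiftMap ⁻¹' cylinder w = cylinder (false :: w) ∪ cylinder (true :: w) := by
  ext x
  simp only [_root_.cylinder, shiftMap, Set.mem_preimage, Set.mem_union, Set.mem_ofPred_eq,
    List.length_cons, Fin.forall_fin_succ]
  cases h : x 0 <;> simp [h]

lemma disjoint_cylinder_cons (w : List Bool) :
    Disjoint (cylinder (false :: w)) (cylinder (true :: w)) := by
  rw [Set.disjoint_left]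
  intro x h0 h1
  have e0 := h0 ⟨0, by simp⟩
  have e1 := h1 ⟨0, by simp⟩
  simp_all

lemma isOpen_cylinder (w : List Bool) : IsOpen (cylinder w) := by
  have h : cylinder w = ⋂ i : Fin w.length, (fun x : Ω => x (i : ℕ)) ⁻¹' {w.get i} := by
    ext x
    simp [_root_.cylinder]
  rw [h]
  exact isOpen_iInter_of_finite fun i =>
    (isOpen_discrete {w.get i}).preimage (continuous_apply (i : ℕ))

lemma isPiSystem_piNat_cylinders :
    IsPiSystem {s : Set Ω | ∃ x n, s = PiNat.cylinder (E := fun _ => Bool) x n} := by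
  rintro _ ⟨x, n, rfl⟩ _ ⟨y, m, rfl⟩ ⟨z, hx, hy⟩
  refine ⟨z, max n m, ?_⟩
  rw [← PiNat.mem_cylinder_iff_eq.1 hx, ← PiNat.mem_cylinder_iff_eq.1 hy]
  ext t
  simp only [Set.mem_inter_iff, PiNat.mem_cylinder_iff, lt_max_iff]
  grind

/-- A measure giving each cylinder `[w]` mass `2^{-ℓ(w)}` is shift-invariant. -/
lemma measurePreserving_shiftMap (μ : Measure Ω) [IsProbabilityMeasure μ]
    (hμ : ∀ w : List Bool, μ (cylinder w) = (1 / 2) ^ w.length) :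
    MeasurePreserving shiftMap μ μ := by
  have hσ : Measurable shiftMap := continuous_shiftMap.measurable
  refine ⟨hσ, ?_⟩
  have : IsProbabilityMeasure (μ.map shiftMap) :=
    Measure.isProbabilityMeasure_map hσ.aemeasurable
  refine ext_of_generate_finite
    {s : Set Ω | ∃ x n, s = PiNat.cylinder (E := fun _ => Bool) x n} ?_
    isPiSystem_piNat_cylinders ?_ (by simp)
  · rw [← (PiNat.isTopologicalBasis_cylinders (fun _ : ℕ => Bool)).borel_eq_generateFrom]
    exact BorelSpace.measurable_eq
  · rintro _ ⟨x, n, rfl⟩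
    rw [← cylinder_ofFn, Measure.map_apply hσ (isOpen_cylinder _).measurableSet,
      preimage_shiftMap_cylinder,
      measure_union (disjoint_cylinder_cons _) (isOpen_cylinder _).measurableSet, hμ, hμ, hμ,
      List.length_cons, List.length_cons, pow_succ, ← mul_add, one_div, ENNReal.inv_two_add_inv_two,
      mul_one]

/-- A measure giving each cylinder `[w]` mass `2^{-ℓ(w)}` has full support. -/
lemma isOpenPosMeasure_of_cylinder (μ : Measure Ω)
    (hμ : ∀ w : List Bool, μ (cylinder w) = (1 / 2) ^ w.length) :
    μ.IsOpenPosMeasure := by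
  refine ⟨fun U hU ⟨x, hx⟩ h0 => ?_⟩
  obtain ⟨_, ⟨y, n, rfl⟩, -, hsub⟩ :=
    (PiNat.isTopologicalBasis_cylinders (fun _ : ℕ => Bool)).exists_subset_of_mem_open hx hU
  have h := measure_mono_null hsub h0
  rw [← cylinder_ofFn, hμ] at h
  exact pow_ne_zero _ (by simp) h

lemma shiftMap_iterate_apply (n : ℕ) (x : Ω) (k : ℕ) : shiftMap^[n] x k = x (k + n) := by
  induction n generalizing x with
  | zero => rfl
  | succ n ih =>
    rw [Function.iterate_succ_apply, ih]
    exact congrArg x (by omega)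

/-- A continuous shift-invariant function on the shift space is constant, because every point
has a dense backward orbit. -/
lemma eq_of_continuous_of_shiftMap_invariant {f : Ω → ℝ} (hf : Continuous f)
    (h : ∀ x, f (shiftMap x) = f x) (x y : Ω) : f x = f y := by
  have hiter : ∀ n z, f (shiftMap^[n] z) = f z := by
    intro n
    induction n with
    | zero => exact fun _ => rfl
    | succ n ih => exact fun z => by rw [Function.iterate_succ_apply, ih, h]
  let z : ℕ → Ω := fun n k => if k < n then x k else y (k - n)
  have hz : ∀ n, f (z n) = f y := by
    intro n
    rw [← hiter n (z n)]
    congr 1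
    ext k
    simp [shiftMap_iterate_apply, z]
  have hlim : Filter.Tendsto z Filter.atTop (nhds x) := by
    refine tendsto_pi_nhds.2 fun k => tendsto_const_nhds.congr' ?_
    filter_upwards [Filter.eventually_gt_atTop k] with n hn
    simp [z, hn]
  have hfz := (hf.tendsto x).comp hlim
  exact tendsto_nhds_unique hfz (tendsto_const_nhds.congr fun n => (hz n).symm)

lemma commD_apply {μ : Measure Ω} (K L A : E μ →L[ℝ] E μ) (φ ψ : E μ) :
    commD K L A (WithLp.toLp 2 (φ, ψ)) =
      WithLp.toLp 2 (K (A ψ) - A (K ψ), L (A φ) - A (L φ)) := rfl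

lemma commD_eq_zero_iff {μ : Measure Ω} (K L A : E μ →L[ℝ] E μ) :
    commD K L A = 0 ↔ (∀ ψ, K (A ψ) = A (K ψ)) ∧ ∀ φ, L (A φ) = A (L φ) := by
  constructor
  · intro h
    have key : ∀ φ ψ : E μ, (K (A ψ) - A (K ψ), L (A φ) - A (L φ)) = (0 : E μ × E μ) := by
      intro φ ψ
      have := congrArg (WithLp.ofLp) (DFunLike.congr_fun h (WithLp.toLp 2 (φ, ψ)))
      rwa [commD_apply] at this
    exact ⟨fun ψ => sub_eq_zero.1 (congrArg Prod.fst (key 0 ψ)),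
      fun φ => sub_eq_zero.1 (congrArg Prod.snd (key φ 0))⟩
  · rintro ⟨hK, hL⟩
    ext1 ⟨φ, ψ⟩
    rw [commD_apply, hK, hL, sub_self, sub_self]
    rfl

/-- If the Koopman operator commutes with multiplication by a continuous function, then that
function is shift-invariant. -/
lemma shiftMap_invariant_of_koopman_comm (μ : Measure Ω) [IsProbabilityMeasure μ]
    [μ.IsOpenPosMeasure] (hσ : MeasurePreserving shiftMap μ μ) (K : E μ →L[ℝ] E μ)
    (hK : ∀ g : E μ, (K g : Ω → ℝ) =ᵐ[μ] fun x => g (shiftMap x))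
    (f : C(Ω, ℝ)) (Mf : E μ →L[ℝ] E μ)
    (hMf : ∀ g : E μ, (Mf g : Ω → ℝ) =ᵐ[μ] fun x => f x * g x)
    (hcomm : ∀ g, K (Mf g) = Mf (K g)) (x : Ω) : f (shiftMap x) = f x := by
  have hmem : MemLp (fun _ : Ω => (1 : ℝ)) 2 μ := memLp_const 1
  let one : E μ := hmem.toLp _
  have hone : (one : Ω → ℝ) =ᵐ[μ] fun _ => 1 := hmem.coeFn_toLp
  have hqmp := hσ.quasiMeasurePreserving
  have hae : (fun x => f (shiftMap x)) =ᵐ[μ] f := by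
    have h1 := hK (Mf one)
    rw [hcomm] at h1
    filter_upwards [h1, hMf (K one), hK one, hqmp.ae hone, hqmp.ae (hMf one)]
      with x h1 h2 h3 h4 h5
    rw [h2, h3, h5, h4, mul_one, mul_one] at h1
    exact h1.symm
  exact congrFun (((f.continuous.comp continuous_shiftMap).ae_eq_iff_eq μ f.continuous).1 hae) x

/-- For a continuous `f`, the following are equivalent: `[D, π(M_f)] = 0`;
`f ∘ σ = f`; `f` is constant. -/
theorem stmt12
    (μ : Measure Ω) [IsProbabilityMeasure μ]
    (hμ : ∀ w : List Bool, μ (cylinder w) = (1 / 2) ^ w.length)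
    (K L : E μ →L[ℝ] E μ)
    (hK : ∀ g : E μ, (K g : Ω → ℝ) =ᵐ[μ] fun x => g (shiftMap x))
    (hL : ∀ g : E μ, (L g : Ω → ℝ) =ᵐ[μ]
      fun x => (g (consSeq false x) + g (consSeq true x)) / 2)
    (hadj : ContinuousLinearMap.adjoint K = L)
    (f : C(Ω, ℝ)) (Mf : E μ →L[ℝ] E μ)
    (hMf : ∀ g : E μ, (Mf g : Ω → ℝ) =ᵐ[μ] fun x => f x * g x) :
    (commD K L Mf = 0 ↔ ∀ x : Ω, f (shiftMap x) = f x) ∧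
    ((∀ x : Ω, f (shiftMap x) = f x) ↔ ∃ c : ℝ, ∀ x : Ω, f x = c) := by
  have : μ.IsOpenPosMeasure := isOpenPosMeasure_of_cylinder μ hμ
  have hconst : (∀ x : Ω, f (shiftMap x) = f x) ↔ ∃ c : ℝ, ∀ x : Ω, f x = c :=
    ⟨fun h => ⟨f fun _ => false,
      fun x => eq_of_continuous_of_shiftMap_invariant f.continuous h x _⟩,
      fun ⟨c, hc⟩ x => by rw [hc, hc]⟩
  refine ⟨⟨fun h => ?_, fun h => ?_⟩, hconst⟩
  · exact shiftMap_invariant_of_koopman_comm μ (measurePreserving_shiftMap μ hμ) K hK f Mf hMf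
      ((commD_eq_zero_iff K L Mf).1 h).1
  · obtain ⟨c, hc⟩ := hconst.1 h
    have hsmul : ∀ g : E μ, Mf g = c • g := by
      intro g
      apply Lp.ext
      filter_upwards [hMf g, Lp.coeFn_smul c g] with x h1 h2
      rw [h1, h2, hc, Pi.smul_apply, smul_eq_mul]
    exact (commD_eq_zero_iff K L Mf).2
      ⟨fun g => by rw [hsmul, hsmul, map_smul], fun g => by rw [hsmul, hsmul, map_smul]⟩
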